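/- Let α > 0 and suppose the spatial and temporal deformation exponents coincide, β = α. Then for every t > 0, (∫₀^∞ x²·exp(−x^{2α}/t^{α}) dx) / (∫₀^∞ exp(−x^{2α}/t^{α}) dx) = C_α·t with C_α = (∫₀^∞ u²·exp(−u^{2α}) du)/(∫₀^∞ exp(−u^{2α}) du); i.e., a Gaussian-like exactly linear mean square variation is observed even for a fractal time process when the two Hausdorff dimensions are equal. -/

import Mathlib

theorem neg_sqrt_mul_rpow_div_rpow {α t u : ℝ} (ht : 0 < t) (hu : 0 ≤ u) :
    -((√t * u) ^ (2 * α)) / t ^ α = -(u ^ (2 * α)) := by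
  have h : √t ^ (2 * α) = t ^ α := by
    rw [Real.rpow_mul (Real.sqrt_nonneg t), Real.rpow_two, Real.sq_sqrt ht.le]
  rw [Real.mul_rpow (Real.sqrt_nonneg t) hu, h, neg_div,
    mul_div_cancel_left₀ _ (Real.rpow_pos_of_pos ht α).ne']

/-- When the spatial and temporal deformation exponents coincide (`β = α`), the mean
square displacement of the stretched-exponential distribution is exactly linear in
time: the ratio of the second moment to the mass equals `C_α·t`. -/
theorem equal_dimensions_linear_mean_square (α t : ℝ) (hα : 0 < α) (ht : 0 < t) :
    (∫ x in Set.Ioi (0:ℝ), x^2 * Real.exp (-(x ^ (2*α)) / t ^ α)) /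
        (∫ x in Set.Ioi (0:ℝ), Real.exp (-(x ^ (2*α)) / t ^ α)) =
      ((∫ u in Set.Ioi (0:ℝ), u^2 * Real.exp (-(u ^ (2*α)))) /
        (∫ u in Set.Ioi (0:ℝ), Real.exp (-(u ^ (2*α))))) * t := by
  have hc : 0 < √t := Real.sqrt_pos.2 ht
  have hmoment := MeasureTheory.integral_comp_mul_left_Ioi'
    (fun x : ℝ => x ^ 2 * Real.exp (-(x ^ (2 * α)) / t ^ α)) 0 hc
  have hmass := MeasureTheory.integral_comp_mul_left_Ioi'
    (fun x : ℝ => Real.exp (-(x ^ (2 * α)) / t ^ α)) 0 hc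
  rw [mul_zero] at hmoment hmass
  rw [← hmoment, ← hmass, smul_eq_mul, smul_eq_mul, mul_div_mul_left _ _ hc.ne']
  have hmoment' : ∫ u in Set.Ioi (0:ℝ),
      (√t * u) ^ 2 * Real.exp (-((√t * u) ^ (2 * α)) / t ^ α) =
      t * ∫ u in Set.Ioi (0:ℝ), u ^ 2 * Real.exp (-(u ^ (2 * α))) := by
    rw [← MeasureTheory.integral_const_mul]
    refine MeasureTheory.setIntegral_congr_fun measurableSet_Ioi fun u hu => ?_
    simp only [neg_sqrt_mul_rpow_div_rpow ht (le_of_lt hu), mul_pow, Real.sq_sqrt ht.le, mul_assoc]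
  have hmass' : ∫ u in Set.Ioi (0:ℝ), Real.exp (-((√t * u) ^ (2 * α)) / t ^ α) =
      ∫ u in Set.Ioi (0:ℝ), Real.exp (-(u ^ (2 * α))) :=
    MeasureTheory.setIntegral_congr_fun measurableSet_Ioi fun u hu => by
      simp only [neg_sqrt_mul_rpow_div_rpow ht (le_of_lt hu)]
  rw [hmoment', hmass', mul_div_assoc, mul_comm]
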